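/- (Distance increase.) Let U be a finite set, let d and d' both be metrics on U such that d'(a,b) = d(a,b) + δ for one fixed unordered pair {a,b} of distinct elements and some δ > 0, and d'(u,v) = d(u,v) for all other pairs. Let w: U → ℝ be non-negative weights, λ ≥ 0, and write φ_d(S) = Σ_{u∈S} w(u) + λ·d(S) and φ_{d'}(S) = Σ_{u∈S} w(u) + λ·d'(S). Suppose S ⊆ U with |S| = p satisfies φ_d(S) ≥ (1/3)·φ_d(T) for every T ⊆ U with |T| = p, and let Δ = max(0, max over y ∈ S and x ∈ U∖S of φ_{d'}((S∖{y})∪{x}) − φ_{d'}(S)). Then φ_{d'}(S) + Δ ≥ (1/3)·φ_{d'}(T) for every T ⊆ U with |T| = p; i.e., for any metric-preserving distance increase an approximation ratio of 3 is maintained with a single oblivious update. -/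

import Mathlib

open Finset

/-- `dispSet d S` is the sum of `d u v` over all unordered pairs `{u,v}` of distinct
elements of `S` (for a symmetric `d` with `d u u = 0`, half the double sum). -/
noncomputable def dispSet {U : Type*} (d : U → U → ℝ) (S : Finset U) : ℝ :=
  (∑ u ∈ S, ∑ v ∈ S, d u v) / 2

/-- The max-sum diversification objective `φ(S) = Σ_{u∈S} w(u) + λ·d(S)`
for a modular quality function given by weights `w`. -/
noncomputable def obj {U : Type*} (w : U → ℝ) (lam : ℝ) (d : U → U → ℝ)
    (S : Finset U) : ℝ :=
  ∑ u ∈ S, w u + lam * dispSet d S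

/-- `bestGain φ S = max(0, max over y ∈ S, x ∉ S of φ((S\{y})∪{x}) - φ(S))`:
the objective gain of the best single swap (the oblivious update rule). -/
noncomputable def bestGain {U : Type*} [Fintype U] [DecidableEq U]
    (φ : Finset U → ℝ) (S : Finset U) : ℝ :=
  (insert (0 : ℝ) ((S ×ˢ (Finset.univ \ S)).image
      fun pr => φ (insert pr.2 (S.erase pr.1)) - φ S)).max'
    (Finset.insert_nonempty _ _)

lemma dispSet_insert {U : Type*} [DecidableEq U] (d : U → U → ℝ)
    (hs : ∀ u v, d u v = d v u) (hr : ∀ u, d u u = 0) (x : U) (R : Finset U) (hx : x ∉ R) :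
    dispSet d (insert x R) = dispSet d R + ∑ u ∈ R, d x u := by
  unfold dispSet
  rw [Finset.sum_insert hx, Finset.sum_insert hx, hr]
  have : ∑ u ∈ R, ∑ v ∈ insert x R, d u v = ∑ u ∈ R, (d x u + ∑ v ∈ R, d u v) := by
    refine Finset.sum_congr rfl fun u _ => ?_
    rw [Finset.sum_insert hx, hs u x]
  rw [this, Finset.sum_add_distrib]
  ring

lemma dispSet_union {U : Type*} [DecidableEq U] (d : U → U → ℝ)
    (hs : ∀ u v, d u v = d v u) (A C : Finset U) (h : Disjoint A C) :
    dispSet d (A ∪ C) = dispSet d A + dispSet d C + ∑ u ∈ A, ∑ v ∈ C, d u v := by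
  unfold dispSet
  simp only [Finset.sum_union h, Finset.sum_add_distrib]
  have : ∑ u ∈ C, ∑ v ∈ A, d u v = ∑ u ∈ A, ∑ v ∈ C, d u v := by
    rw [Finset.sum_comm]
    exact Finset.sum_congr rfl fun u _ => Finset.sum_congr rfl fun v _ => hs _ _
  rw [this]
  ring

lemma gain_le {U : Type*} [Fintype U] [DecidableEq U] (d : U → U → ℝ)
    (hs : ∀ u v, d u v = d v u) (hr : ∀ u, d u u = 0) (w : U → ℝ) (lam : ℝ)
    (S : Finset U) (x y : U) (hy : y ∈ S) (hx : x ∉ S) :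
    w x - w y + lam * (∑ u ∈ S, d x u - d x y - ∑ u ∈ S, d y u)
      ≤ bestGain (obj w lam d) S := by
  have h1 : obj w lam d (insert x (S.erase y)) - obj w lam d S ≤ bestGain (obj w lam d) S := by
    unfold bestGain
    apply Finset.le_max'
    apply Finset.mem_insert_of_mem
    exact Finset.mem_image.2 ⟨(y, x), by simp [hy, hx], rfl⟩
  refine le_trans (le_of_eq ?_) h1
  have hyR : y ∉ S.erase y := by simp
  have hxR : x ∉ S.erase y := fun h => hx (Finset.mem_of_mem_erase h)
  have e : S = insert y (S.erase y) := (Finset.insert_erase hy).symm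
  unfold obj
  generalize S.erase y = R at *
  subst e
  rw [dispSet_insert d hs hr _ _ hyR, dispSet_insert d hs hr _ _ hxR]
  simp only [Finset.sum_insert hyR, Finset.sum_insert hxR, hr]
  ring

lemma gain_nonneg {U : Type*} [Fintype U] [DecidableEq U] (φ : Finset U → ℝ) (S : Finset U) :
    0 ≤ bestGain φ S := by
  unfold bestGain
  exact Finset.le_max' _ _ (Finset.mem_insert_self _ _)

lemma dispSet_nonneg {U : Type*} (d : U → U → ℝ) (hn : ∀ u v, 0 ≤ d u v) (S : Finset U) :
    0 ≤ dispSet d S := by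
  unfold dispSet
  have : 0 ≤ ∑ u ∈ S, ∑ v ∈ S, d u v :=
    Finset.sum_nonneg fun u _ => Finset.sum_nonneg fun v _ => hn u v
  linarith

lemma tri_avg {U : Type*} [DecidableEq U] (d : U → U → ℝ)
    (hs : ∀ u v, d u v = d v u) (hr : ∀ u, d u u = 0) 
    (ht : ∀ u v w, d u w ≤ d u v + d v w) (A B : Finset U) (m : ℝ) (hA : (A.card : ℝ) = m)
    (hB : (B.card : ℝ) = m) :
    m * dispSet d B ≤ (m - 1) * ∑ x ∈ B, ∑ y ∈ A, d x y := by
  have key : ∀ y ∈ A, ∑ x ∈ B, ∑ x' ∈ B, d x x' ≤ 2 * (m - 1) * ∑ x ∈ B, d x y := by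
    intro y _
    have : ∀ x ∈ B, ∑ x' ∈ B, d x x' ≤ m * d x y + ∑ x' ∈ B, d x' y - 2 * d x y := by
      intro x hx
      have h1 : ∑ x' ∈ B.erase x, d x x' ≤ ∑ x' ∈ B.erase x, (d x y + d x' y) :=
        Finset.sum_le_sum fun x' _ => by rw [hs x' y]; exact ht _ _ _
      have h2 := Finset.add_sum_erase B (fun x' => d x x') hx
      have h3 := Finset.add_sum_erase B (fun x' => d x y + d x' y) hx
      simp only [Finset.sum_add_distrib, Finset.sum_const, nsmul_eq_mul, hB] at h3 h1
      rw [hr] at h2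
      linarith
    refine (Finset.sum_le_sum this).trans (le_of_eq ?_)
    simp only [Finset.sum_sub_distrib, Finset.sum_add_distrib, Finset.sum_const, nsmul_eq_mul,
      hB, ← Finset.mul_sum]
    ring
  have := Finset.sum_le_sum key
  rw [← Finset.mul_sum, Finset.sum_const, nsmul_eq_mul, hA,
    Finset.sum_comm (s := A) (t := B)] at this
  unfold dispSet
  linarith

lemma local_search {U : Type*} [Fintype U] [DecidableEq U] (d : U → U → ℝ)
    (hs : ∀ u v, d u v = d v u) (hn : ∀ u v, 0 ≤ d u v) (hr : ∀ u, d u u = 0)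
    (ht : ∀ u v w, d u w ≤ d u v + d v w) (w : U → ℝ) (hw : ∀ u, 0 ≤ w u)
    (lam : ℝ) (hl : 0 ≤ lam) (S T : Finset U) (hc : S.card = T.card) :
    obj w lam d T ≤ 2 * obj w lam d S + S.card * bestGain (obj w lam d) S := by
  have hΔ := gain_nonneg (obj w lam d) S
  have G := gain_le d hs hr w lam S
  generalize bestGain (obj w lam d) S = Δ at *
  obtain ⟨m, hm⟩ : ∃ m : ℝ, ((S \ T).card : ℝ) = m := ⟨_, rfl⟩
  have hmB : ((T \ S).card : ℝ) = m := by
    rw [← hm, Finset.card_sdiff_comm hc]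
  have hmS : m ≤ S.card := by
    rw [← hm]; exact_mod_cast Finset.card_le_card Finset.sdiff_subset
  have hm0 : 0 ≤ m := by rw [← hm]; positivity
  have eS : S = (S \ T) ∪ (S ∩ T) := (Finset.sdiff_union_inter S T).symm
  have eT : T = (T \ S) ∪ (S ∩ T) := by
    rw [Finset.inter_comm]; exact (Finset.sdiff_union_inter T S).symm
  have dS : Disjoint (S \ T) (S ∩ T) := by
    rw [Finset.disjoint_left]; intro x; simp; tauto
  have dT : Disjoint (T \ S) (S ∩ T) := by
    rw [Finset.disjoint_left]; intro x; simp; tauto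
  have tri := tri_avg d hs hr ht (S \ T) (T \ S) m hm hmB
  have G2 : ∀ x ∈ T \ S, ∀ y ∈ S \ T, w x - w y + lam * ((∑ u ∈ S \ T, d x u + ∑ u ∈ S ∩ T, d x u)
      - d x y - (∑ u ∈ S \ T, d y u + ∑ u ∈ S ∩ T, d y u)) ≤ Δ := by
    intro x hx y hy
    rw [← Finset.sum_union dS, ← Finset.sum_union dS, ← eS]
    exact G x y (Finset.mem_sdiff.1 hy).1 (Finset.mem_sdiff.1 hx).2
  have hC := dispSet_nonneg d hn (S ∩ T)
  have hwA : 0 ≤ ∑ u ∈ S \ T, w u := Finset.sum_nonneg fun u _ => hw u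
  have hwC : 0 ≤ ∑ u ∈ S ∩ T, w u := Finset.sum_nonneg fun u _ => hw u
  have hAC : 0 ≤ ∑ u ∈ S \ T, ∑ v ∈ S ∩ T, d u v :=
    Finset.sum_nonneg fun u _ => Finset.sum_nonneg fun v _ => hn u v
  have oS : obj w lam d S = (∑ u ∈ S \ T, w u + ∑ u ∈ S ∩ T, w u) + lam *
      (dispSet d (S \ T) + dispSet d (S ∩ T) + ∑ u ∈ S \ T, ∑ v ∈ S ∩ T, d u v) := by
    rw [← dispSet_union d hs _ _ dS, ← Finset.sum_union dS, ← eS]; rfl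
  have oT : obj w lam d T = (∑ u ∈ T \ S, w u + ∑ u ∈ S ∩ T, w u) + lam *
      (dispSet d (T \ S) + dispSet d (S ∩ T) + ∑ u ∈ T \ S, ∑ v ∈ S ∩ T, d u v) := by
    rw [← dispSet_union d hs _ _ dT, ← Finset.sum_union dT, ← eT]; rfl
  rcases hm0.eq_or_lt with h0 | h0
  · have : T \ S = ∅ := by
      rw [← Finset.card_eq_zero]; rw [← h0] at hmB; exact_mod_cast hmB
    rw [this] at oT
    have hA := dispSet_nonneg d hn (S \ T)
    have hp : (0:ℝ) ≤ S.card * Δ := mul_nonneg (Nat.cast_nonneg _) hΔ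
    have hz : dispSet d (∅ : Finset U) = 0 := by
      unfold dispSet
      rw [Finset.sum_empty, zero_div]
    have h1 := mul_nonneg hl hA
    have h2 := mul_nonneg hl hC
    have h3 := mul_nonneg hl hAC
    simp only [hz, Finset.sum_empty] at oT
    nlinarith
  have hA2 : dispSet d (S \ T) = (∑ y ∈ S \ T, ∑ u ∈ S \ T, d y u) / 2 := rfl
  have sumG := Finset.sum_le_sum fun x hx => Finset.sum_le_sum (G2 x hx)
  simp only [Finset.sum_sub_distrib, Finset.sum_add_distrib, Finset.sum_const, nsmul_eq_mul,
      hm, hmB, ← Finset.mul_sum] at sumG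
  have fin : m * obj w lam d T ≤ m * (2 * obj w lam d S + m * Δ) := by
    rw [oS, oT]
    have t := mul_le_mul_of_nonneg_left tri hl
    have h1 := mul_nonneg hm0 (mul_nonneg hl hC)
    have h3 := mul_nonneg hm0 (mul_nonneg hl hAC)
    have h4 := mul_nonneg hm0 hwA
    have h5 := mul_nonneg hm0 hwC
    rw [hA2]
    nlinarith
  have := le_of_mul_le_mul_left fin h0
  have := mul_le_mul_of_nonneg_right hmS hΔ
  linarith

/-- exactly one endpoint in `S` -/
lemma case_one {U : Type*} [Fintype U] [DecidableEq U] (d : U → U → ℝ)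
    (hs : ∀ u v, d u v = d v u) (hn : ∀ u v, 0 ≤ d u v) (hr : ∀ u, d u u = 0)
    (ht : ∀ u v w, d u w ≤ d u v + d v w) (w : U → ℝ) (hw : ∀ u, 0 ≤ w u)
    (lam : ℝ) (hl : 0 ≤ lam) (S : Finset U) (a b : U) (ha : a ∈ S) (hb : b ∉ S)
    (δ : ℝ) (hδ : δ ≤ d a b) (P : ℝ) (hP : (S.card : ℝ) = P) (hP3 : 3 ≤ P) :
    (P - 1) ^ 2 * (lam * δ) - (2 * P - 4) * obj w lam d S
      ≤ (P - 1) * bestGain (obj w lam d) S := by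
  have G : ∀ y ∈ S.erase a, _ := fun y hy =>
    gain_le d hs hr w lam S b y (Finset.mem_of_mem_erase hy) hb
  have sumG := Finset.sum_le_sum G
  have hcard : ((S.erase a).card : ℝ) = P - 1 := by
    rw [Finset.card_erase_of_mem ha, Nat.cast_sub (Finset.card_pos.2 ⟨a, ha⟩), hP]; simp
  have e1 := Finset.add_sum_erase S w ha
  have e2 := Finset.add_sum_erase S (fun y => d b y) ha
  have e3 := Finset.add_sum_erase S (fun y => ∑ u ∈ S, d y u) ha
  simp only [Finset.sum_sub_distrib, Finset.sum_add_distrib, Finset.sum_const, nsmul_eq_mul,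
      hcard, ← Finset.mul_sum] at sumG
  have hD : dispSet d S = (∑ y ∈ S, ∑ u ∈ S, d y u) / 2 := rfl
  have hXA : P * δ ≤ ∑ u ∈ S, d b u + ∑ u ∈ S, d a u := by
    rw [← Finset.sum_add_distrib, ← hP, ← nsmul_eq_mul, ← Finset.sum_const]
    refine Finset.sum_le_sum fun u _ => ?_
    have := ht a u b
    rw [hs u b] at this
    linarith
  have hA : ∑ u ∈ S, d a u ≤ 2 * dispSet d S := by
    have : 0 ≤ ∑ y ∈ S.erase a, ∑ u ∈ S, d y u :=
      Finset.sum_nonneg fun u _ => Finset.sum_nonneg fun v _ => hn u v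
    linarith
  have hW : 0 ≤ ∑ u ∈ S, w u := Finset.sum_nonneg fun u _ => hw u
  have hba : δ ≤ d b a := by rw [hs]; exact hδ
  unfold obj at *
  have hwa := hw a
  have hwb := mul_nonneg (by linarith : (0:ℝ) ≤ P - 1) (hw b)
  have k1 := mul_le_mul_of_nonneg_left hXA (by linarith : (0:ℝ) ≤ P - 2)
  have k2 := mul_le_mul_of_nonneg_left hA (by linarith : (0:ℝ) ≤ P - 3)
  have k3 := mul_nonneg (by linarith : (0:ℝ) ≤ 2 * P - 5) hW
  generalize ∑ u ∈ S, d b u = X at *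
  generalize ∑ u ∈ S, d a u = A at *
  generalize ∑ u ∈ S, w u = W at *
  generalize dispSet d S = D at *
  have k4 : (P - 1) ^ 2 * δ - (2 * P - 4) * D ≤ (P - 1) * X - (X - d b a) - (2 * D - A) := by
    nlinarith
  have k5 := mul_le_mul_of_nonneg_left k4 hl
  have r2 : ∑ y ∈ S.erase a, d b y = X - d b a := by linarith
  have r3 : ∑ y ∈ S.erase a, ∑ u ∈ S, d y u = 2 * D - A := by linarith
  have r1 : ∑ y ∈ S.erase a, w y = W - w a := by linarith
  rw [r1, r2, r3] at sumG
  linarith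

/-- no endpoint in `S` -/
lemma case_none {U : Type*} [Fintype U] [DecidableEq U] (d : U → U → ℝ)
    (hs : ∀ u v, d u v = d v u) (hr : ∀ u, d u u = 0)
    (ht : ∀ u v w, d u w ≤ d u v + d v w) (w : U → ℝ) (hw : ∀ u, 0 ≤ w u)
    (lam : ℝ) (hl : 0 ≤ lam) (S : Finset U) (a b : U) (ha : a ∉ S) (hb : b ∉ S)
    (δ : ℝ) (hδ : δ ≤ d a b) (P : ℝ) (hP : (S.card : ℝ) = P) (hP3 : 3 ≤ P) :
    (P - 1) * P * (lam * δ) - 4 * obj w lam d S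
      ≤ 2 * P * bestGain (obj w lam d) S := by
  have sa := Finset.sum_le_sum fun y hy => gain_le d hs hr w lam S a y hy ha
  have sb := Finset.sum_le_sum fun y hy => gain_le d hs hr w lam S b y hy hb
  simp only [Finset.sum_sub_distrib, Finset.sum_add_distrib, Finset.sum_const, nsmul_eq_mul,
      hP, ← Finset.mul_sum] at sa sb
  have hD : dispSet d S = (∑ y ∈ S, ∑ u ∈ S, d y u) / 2 := rfl
  have hXA : P * δ ≤ ∑ u ∈ S, d b u + ∑ u ∈ S, d a u := by
    rw [← Finset.sum_add_distrib, ← hP, ← nsmul_eq_mul, ← Finset.sum_const]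
    refine Finset.sum_le_sum fun u _ => ?_
    have := ht a u b
    rw [hs u b] at this
    linarith
  have hW : 0 ≤ ∑ u ∈ S, w u := Finset.sum_nonneg fun u _ => hw u
  have hwa := mul_nonneg (by linarith : (0:ℝ) ≤ P) (hw a)
  have hwb := mul_nonneg (by linarith : (0:ℝ) ≤ P) (hw b)
  have k1 := mul_le_mul_of_nonneg_left
    (mul_le_mul_of_nonneg_left hXA (by linarith : (0:ℝ) ≤ P - 1)) hl
  have r3 : ∑ y ∈ S, ∑ u ∈ S, d y u = 2 * dispSet d S := by linarith
  rw [r3] at sa sb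
  unfold obj at *
  linarith

/-- Distance increase: if `S` is a 3-approximation under the metric `d`, and the metric
`d'` increases the distance of the single pair `{a,b}` by `δ > 0` (all other distances
unchanged), then a single oblivious update restores the 3-approximation under `d'`. -/
theorem stmt_16 {U : Type*} [Fintype U] [DecidableEq U] (d d' : U → U → ℝ)
    (hsymm : ∀ u v, d u v = d v u)
    (hnonneg : ∀ u v, 0 ≤ d u v)
    (hrefl : ∀ u, d u u = 0)
    (htri : ∀ u v w, d u w ≤ d u v + d v w)
    (hsymm' : ∀ u v, d' u v = d' v u)
    (hnonneg' : ∀ u v, 0 ≤ d' u v)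
    (hrefl' : ∀ u, d' u u = 0)
    (htri' : ∀ u v w, d' u w ≤ d' u v + d' v w)
    (a b : U) (hab : a ≠ b) (δ : ℝ) (hδ : 0 < δ)
    (hchange : d' a b = d a b + δ)
    (hsame : ∀ u v, ¬((u = a ∧ v = b) ∨ (u = b ∧ v = a)) → d' u v = d u v)
    (w : U → ℝ) (hw : ∀ u, 0 ≤ w u)
    (lam : ℝ) (hlam : 0 ≤ lam)
    (p : ℕ) (S : Finset U) (hS : S.card = p)
    (happrox : ∀ T : Finset U, T.card = p → obj w lam d S ≥ (1 / 3) * obj w lam d T) :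
    ∀ T : Finset U, T.card = p →
      obj w lam d' S + bestGain (obj w lam d') S ≥ (1 / 3) * obj w lam d' T := by
  intro T hT
  have hD' : ∀ u v, d u v ≤ d' u v := by
    intro u v
    by_cases h : (u = a ∧ v = b) ∨ (u = b ∧ v = a)
    · rcases h with ⟨rfl, rfl⟩ | ⟨rfl, rfl⟩
      · linarith
      · rw [hsymm, hsymm' u v]; linarith
    · exact (hsame u v h).ge
  have hmono : ∀ R : Finset U, obj w lam d R ≤ obj w lam d' R := by
    intro R
    unfold obj dispSet
    have : ∑ u ∈ R, ∑ v ∈ R, d u v ≤ ∑ u ∈ R, ∑ v ∈ R, d' u v :=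
      Finset.sum_le_sum fun u _ => Finset.sum_le_sum fun v _ => hD' u v
    have := mul_le_mul_of_nonneg_left
      (div_le_div_of_nonneg_right this (by norm_num : (0:ℝ) ≤ 2)) hlam
    linarith
  have hnot : ∀ R : Finset U, ¬ (a ∈ R ∧ b ∈ R) → obj w lam d' R = obj w lam d R := by
    intro R hR
    unfold obj dispSet
    have : ∑ u ∈ R, ∑ v ∈ R, d' u v = ∑ u ∈ R, ∑ v ∈ R, d u v := by
      refine Finset.sum_congr rfl fun u hu => Finset.sum_congr rfl fun v hv => hsame u v ?_
      rintro (⟨rfl, rfl⟩ | ⟨rfl, rfl⟩)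
      · exact hR ⟨hu, hv⟩
      · exact hR ⟨hv, hu⟩
    rw [this]
  have hboth : ∀ R : Finset U, a ∈ R → b ∈ R →
      obj w lam d' R = obj w lam d R + lam * δ := by
    intro R haR hbR
    have hbE : b ∈ R.erase a := Finset.mem_erase.2 ⟨hab.symm, hbR⟩
    have e : R = insert a (R.erase a) := (Finset.insert_erase haR).symm
    have haE : a ∉ R.erase a := by simp
    have h0 := hnot (R.erase a) (fun h => haE h.1)
    have hrow : ∑ u ∈ R.erase a, d' a u = ∑ u ∈ R.erase a, d a u + δ := by
      rw [← Finset.add_sum_erase _ _ hbE, ← Finset.add_sum_erase _ (fun u => d a u) hbE,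
        hchange]
      have : ∑ u ∈ (R.erase a).erase b, d' a u = ∑ u ∈ (R.erase a).erase b, d a u := by
        refine Finset.sum_congr rfl fun u hu => hsame a u ?_
        rintro (⟨_, rfl⟩ | ⟨h, _⟩)
        · simp at hu
        · exact hab h
      rw [this]; ring
    rw [e]
    unfold obj at *
    rw [dispSet_insert d hsymm hrefl _ _ haE, dispSet_insert d' hsymm' hrefl' _ _ haE,
      Finset.sum_insert haE, hrow]
    linarith
  have hΔ := gain_nonneg (obj w lam d') S
  have hTa := happrox T hT
  have hL : 0 ≤ lam * δ := mul_nonneg hlam hδ.le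
  by_cases hTab : a ∈ T ∧ b ∈ T
  swap
  · rw [hnot T hTab]
    linarith [hmono S]
  have hT' := hboth T hTab.1 hTab.2
  by_cases hSab : a ∈ S ∧ b ∈ S
  · rw [hboth S hSab.1 hSab.2, hT']
    linarith
  by_contra hcon
  push Not at hcon
  have hls := local_search d' hsymm' hnonneg' hrefl' htri' w hw lam hlam S T (by rw [hS, hT])
  have hs0 : 0 ≤ obj w lam d' S := by
    unfold obj
    have := mul_nonneg hlam (dispSet_nonneg d' hnonneg' S)
    have : 0 ≤ ∑ u ∈ S, w u := Finset.sum_nonneg fun u _ => hw u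
    linarith
  have hSS := hnot S hSab
  obtain ⟨P, hP⟩ : ∃ P : ℝ, (S.card : ℝ) = P := ⟨_, rfl⟩
  have hδ' : δ ≤ d' a b := by linarith [hnonneg a b]
  have hδ'' : δ ≤ d' b a := by rw [hsymm']; exact hδ'
  have c1 := case_one d' hsymm' hnonneg' hrefl' htri' w hw lam hlam S a b
  have c2 := case_one d' hsymm' hnonneg' hrefl' htri' w hw lam hlam S b a
  have c0 := case_none d' hsymm' hrefl' htri' w hw lam hlam S a b
  rw [hP] at hls
  generalize bestGain (obj w lam d') S = Δ at *
  rw [← hSS] at hTa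
  generalize obj w lam d' S = s at *
  have h3 : 3 * Δ < lam * δ := by linarith
  have hsP : s < (P - 3) * Δ := by linarith
  have hprod : 0 < (P - 3) * Δ := lt_of_le_of_lt hs0 hsP
  have hΔ0 : 0 < Δ := by
    rcases hΔ.eq_or_lt with h | h
    · rw [← h] at hprod; simp at hprod
    · exact h
  have hP3 : 3 < P := by
    have := pos_of_mul_pos_left hprod hΔ
    linarith
  have fin1 : ¬ ((P - 1) ^ 2 * (lam * δ) - (2 * P - 4) * s ≤ (P - 1) * Δ) := by
    intro h
    have q1 := mul_le_mul_of_nonneg_left h3.le (sq_nonneg (P - 1))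
    have q2 := mul_le_mul_of_nonneg_left hsP.le (by linarith : (0:ℝ) ≤ 2 * P - 4)
    have q3 : 0 < Δ * (P ^ 2 + 3 * P - 8) := mul_pos hΔ0 (by nlinarith)
    linarith
  have fin0 : ¬ ((P - 1) * P * (lam * δ) - 4 * s ≤ 2 * P * Δ) := by
    intro h
    have q1 := mul_le_mul_of_nonneg_left h3.le
      (mul_nonneg (by linarith : (0:ℝ) ≤ P - 1) (by linarith : (0:ℝ) ≤ P))
    have q3 : 0 < Δ * (3 * P ^ 2 - 9 * P + 12) := mul_pos hΔ0 (by nlinarith)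
    linarith
  by_cases haS : a ∈ S
  · exact fin1 (c1 haS (fun h => hSab ⟨haS, h⟩) δ hδ' P hP hP3.le)
  · by_cases hbS : b ∈ S
    · exact fin1 (c2 hbS haS δ hδ'' P hP hP3.le)
    · exact fin0 (c0 haS hbS δ hδ' P hP hP3.le)
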